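/- arXiv:2206.12621 — 5 statements merged into one kernel-verified Lean document; each statement's English description precedes it below -/
import Mathlib

section
/- In the two-group model, in any equilibrium σ, if σ(ℓ,{1},tribal)>0 then σ(ℓ,{2},denial)>0. -/
open Finset
open scoped Classical

/-- A policy: `l` (the "populist" policy ℓ) or `h` (the rational policy). -/
inductive Policy where
  | l : Policy
  | h : Policy
  deriving DecidableEq

instance : Fintype Policy :=
  ⟨{Policy.l, Policy.h}, fun x => by cases x <;> simp⟩

/-- A narrative `S ⊆ {0,…,n}`: the first component records whether the policy
variable (index 0) belongs to `S`, the second records `S ∩ N`. -/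
abbrev Narrative (n : ℕ) := Bool × Finset (Fin n)

/-- A platform: a policy, a coalition of social groups, and a narrative. -/
abbrev Platform (n : ℕ) := Policy × Finset (Fin n) × Narrative n

namespace FN

variable {n : ℕ}

/-- The true narrative `S = {0}`. -/
def trueNarr (n : ℕ) : Narrative n := (true, ∅)

/-- The denialist narrative `S = ∅`. -/
def denialNarr (n : ℕ) : Narrative n := (false, ∅)

/-- `x_S(a,C) = x_S(a',C')`: the variables postulated by the narrative `S` take the
same values at `(a,C)` and `(a',C')`. -/
def Agrees (S : Narrative n) (a : Policy) (C : Finset (Fin n))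
    (a' : Policy) (C' : Finset (Fin n)) : Prop :=
  (S.1 = true → a = a') ∧ ∀ i ∈ S.2, (i ∈ C ↔ i ∈ C')

/-- The long-run conditional probability `p_σ(y = 1 ∣ x_S(a,C))`: using
`Pr(y=1∣h) = q`, `Pr(y=1∣ℓ) = 0`, it is `q` times the σ-mass of platforms with
policy `h` agreeing with `(a,C)` on `S`, divided by the σ-mass of all platforms
agreeing with `(a,C)` on `S`. -/
noncomputable def condProb (q : ℝ) (σ : Platform n → ℝ) (a : Policy)
    (C : Finset (Fin n)) (S : Narrative n) : ℝ :=
  (q * ∑ z ∈ univ.filter (fun z : Platform n =>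
      z.1 = Policy.h ∧ Agrees S a C z.1 z.2.1), σ z) /
    ∑ z ∈ univ.filter (fun z : Platform n => Agrees S a C z.1 z.2.1), σ z

/-- The platform payoff `U_σ(a,C,S) = Σ_{i∈C} p_σ(y=1∣x_S(a,C)) · f_i(a)`. -/
noncomputable def payoff (q : ℝ) (f : Fin n → Policy → ℝ) (σ : Platform n → ℝ)
    (z : Platform n) : ℝ :=
  ∑ i ∈ z.2.1, condProb q σ z.1 z.2.1 z.2.2 * f i z.1

/-- A coalition `C` is admissible given policy `a` if it is a nonempty strict
subset of `N` and every member intrinsically supports `a`. -/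
def Admissible (f : Fin n → Policy → ℝ) (a : Policy) (C : Finset (Fin n)) : Prop :=
  C.Nonempty ∧ C ≠ univ ∧ ∀ i ∈ C, 0 < f i a

/-- A valid platform: admissible coalition and feasible narrative. -/
def Valid (f : Fin n → Policy → ℝ) (feas : Narrative n → Prop) (z : Platform n) : Prop :=
  Admissible f z.1 z.2.1 ∧ feas z.2.2

/-- `σ` is a probability distribution over platforms. -/
def IsDist (σ : Platform n → ℝ) : Prop :=
  (∀ z, 0 ≤ σ z) ∧ ∑ z, σ z = 1

/-- An ε-equilibrium: a full-support distribution (over valid platforms) such that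
every platform with probability above ε maximizes the payoff among valid platforms. -/
def EpsEquilibrium (q : ℝ) (f : Fin n → Policy → ℝ) (feas : Narrative n → Prop)
    (ε : ℝ) (σ : Platform n → ℝ) : Prop :=
  IsDist σ ∧ (∀ z, 0 < σ z ↔ Valid f feas z) ∧
    ∀ z, Valid f feas z → ε < σ z →
      ∀ z', Valid f feas z' → payoff q f σ z' ≤ payoff q f σ z

/-- An equilibrium: a (pointwise) limit of ε-equilibria as ε → 0. -/
def Equilibrium (q : ℝ) (f : Fin n → Policy → ℝ) (feas : Narrative n → Prop)
    (σ : Platform n → ℝ) : Prop :=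
  ∃ (ε : ℕ → ℝ) (σs : ℕ → Platform n → ℝ),
    (∀ k, 0 < ε k) ∧ Filter.Tendsto ε Filter.atTop (nhds 0) ∧
    (∀ k, EpsEquilibrium q f feas (ε k) (σs k)) ∧
    (∀ z, Filter.Tendsto (fun k => σs k z) Filter.atTop (nhds (σ z)))

/-- An essential equilibrium: supported platforms with a false narrative strictly
outperform the true narrative on the same policy-coalition pair, and supported
narratives `S ⊆ N` strictly outperform all strict subset narratives. -/
def Essential (q : ℝ) (f : Fin n → Policy → ℝ) (feas : Narrative n → Prop)
    (σ : Platform n → ℝ) : Prop :=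
  Equilibrium q f feas σ ∧
  (∀ a C (S : Narrative n), 0 < σ (a, C, S) → S ≠ trueNarr n →
      payoff q f σ (a, C, trueNarr n) < payoff q f σ (a, C, S)) ∧
  (∀ a C (S : Finset (Fin n)), 0 < σ (a, C, ((false, S) : Narrative n)) →
      ∀ S' : Finset (Fin n), S' ⊂ S →
        payoff q f σ (a, C, ((false, S') : Narrative n)) <
          payoff q f σ (a, C, ((false, S) : Narrative n)))

/-- `N^a`: the set of groups with positive mobilization potential for `a`. -/
noncomputable def Nset (f : Fin n → Policy → ℝ) (a : Policy) : Finset (Fin n) :=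
  univ.filter (fun i => 0 < f i a)

/-- `F(a,M) = Σ_{i∈M} f_i(a)`: the aggregate mobilization potential for `a` in `M`. -/
def Fval (f : Fin n → Policy → ℝ) (a : Policy) (M : Finset (Fin n)) : ℝ :=
  ∑ i ∈ M, f i a

/-- Standing assumptions on the mobilization potentials: nonnegativity, every group
supports some policy, every policy is supported by some group. -/
def FOK (f : Fin n → Policy → ℝ) : Prop :=
  (∀ i a, 0 ≤ f i a) ∧ (∀ i, ∃ a, 0 < f i a) ∧ (∀ a, ∃ i, 0 < f i a)

/-- Standing assumptions on the family `𝒮` in the fragmented-society model. -/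
def FamilyOK (f : Fin n → Policy → ℝ) (𝒮 : Finset (Finset (Fin n))) : Prop :=
  (univ \ Nset f Policy.h).Nonempty ∧ (univ \ Nset f Policy.l).Nonempty ∧
  (Nset f Policy.l ∩ Nset f Policy.h).Nonempty ∧
  univ \ Nset f Policy.h ∈ 𝒮 ∧ univ \ Nset f Policy.l ∈ 𝒮 ∧
  Nset f Policy.l ∩ Nset f Policy.h ∈ 𝒮 ∧ (∅ : Finset (Fin n)) ∈ 𝒮 ∧
  ∀ S ∈ 𝒮, S ⊆ univ \ Nset f Policy.h ∨ S ⊆ univ \ Nset f Policy.l ∨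
    S ⊆ Nset f Policy.l ∩ Nset f Policy.h

/-- In the fragmented-society model, a narrative is feasible iff `S ∖ {0} ∈ 𝒮`. -/
def fragFeas (𝒮 : Finset (Finset (Fin n))) : Narrative n → Prop :=
  fun S => S.2 ∈ 𝒮

end FN

namespace FN

/-- The tribal narrative `{1}` in the two-group model (group 1 is index `0`). -/
def tribalNarr : Narrative 2 := (false, ({0} : Finset (Fin 2)))

/-- The feasible narratives in the two-group model: true, denial, tribal. -/
def twoFeas : Narrative 2 → Prop := fun S =>
  S = trueNarr 2 ∨ S = denialNarr 2 ∨ S = tribalNarr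

end FN

namespace FN

noncomputable def sM1 (τ : Platform 2 → ℝ) : ℝ := ∑ z, if (0 : Fin 2) ∈ z.2.1 then τ z else 0
noncomputable def sM2 (τ : Platform 2 → ℝ) : ℝ := ∑ z, if (0 : Fin 2) ∈ z.2.1 then 0 else τ z
noncomputable def sH1 (τ : Platform 2 → ℝ) : ℝ :=
  ∑ z, if z.1 = Policy.h ∧ (0 : Fin 2) ∈ z.2.1 then τ z else 0
noncomputable def sH2 (τ : Platform 2 → ℝ) : ℝ :=
  ∑ z, if z.1 = Policy.h ∧ (0 : Fin 2) ∉ z.2.1 then τ z else 0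
noncomputable def sH (τ : Platform 2 → ℝ) : ℝ :=
  ∑ z, if z.1 = Policy.h then τ z else 0

lemma sM_add (τ : Platform 2 → ℝ) : sM1 τ + sM2 τ = ∑ z, τ z := by
  unfold sM1 sM2
  rw [← Finset.sum_add_distrib]
  refine Finset.sum_congr rfl fun z _ => ?_
  split_ifs <;> simp

lemma sH_add (τ : Platform 2 → ℝ) : sH1 τ + sH2 τ = sH τ := by
  unfold sH1 sH2 sH
  rw [← Finset.sum_add_distrib]
  refine Finset.sum_congr rfl fun z _ => ?_
  by_cases h1 : z.1 = Policy.h <;> by_cases h2 : (0 : Fin 2) ∈ z.2.1 <;> simp [h1, h2]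

lemma pay_t1 (q : ℝ) (f : Fin 2 → Policy → ℝ) (τ : Platform 2 → ℝ) (a : Policy) :
    payoff q f τ (a, {0}, tribalNarr) = q * sH1 τ / sM1 τ * f 0 a := by
  simp [payoff, condProb, Agrees, tribalNarr, sH1, sM1, Finset.sum_filter]

lemma pay_t2 (q : ℝ) (f : Fin 2 → Policy → ℝ) (τ : Platform 2 → ℝ) (a : Policy) :
    payoff q f τ (a, {1}, tribalNarr) = q * sH2 τ / sM2 τ * f 1 a := by
  simp [payoff, condProb, Agrees, tribalNarr, sH2, sM2, Finset.sum_filter]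

lemma pay_d (q : ℝ) (f : Fin 2 → Policy → ℝ) (τ : Platform 2 → ℝ) (h : ∑ z, τ z = 1)
    (a : Policy) (i : Fin 2) :
    payoff q f τ (a, {i}, denialNarr 2) = q * sH τ * f i a := by
  simp [payoff, condProb, Agrees, denialNarr, sH, Finset.sum_filter, h]

lemma pay_lt (q : ℝ) (f : Fin 2 → Policy → ℝ) (τ : Platform 2 → ℝ) (i : Fin 2) :
    payoff q f τ (Policy.l, {i}, trueNarr 2) = 0 := by
  have : ∀ z : Platform 2, ¬ (z.1 = Policy.h ∧ Policy.l = z.1) := by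
    rintro z ⟨h1, h2⟩
    rw [h1] at h2
    cases h2
  simp [payoff, condProb, Agrees, trueNarr, this]

lemma pay_ht (q : ℝ) (f : Fin 2 → Policy → ℝ) (τ : Platform 2 → ℝ) (i : Fin 2)
    (h : 0 < sH τ) :
    payoff q f τ (Policy.h, {i}, trueNarr 2) = q * f i Policy.h := by
  have e : ∀ z : Platform 2, (z.1 = Policy.h ∧ Policy.h = z.1) ↔ z.1 = Policy.h :=
    fun z => ⟨fun h => h.1, fun h => ⟨h, h.symm⟩⟩
  have e' : ∀ z : Platform 2, (Policy.h = z.1) ↔ z.1 = Policy.h := fun z => eq_comm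
  have : payoff q f τ (Policy.h, {i}, trueNarr 2) = q * sH τ / sH τ * f i Policy.h := by
    simp [payoff, condProb, Agrees, trueNarr, sH, Finset.sum_filter, e']
  rw [this, mul_div_assoc, div_self h.ne', mul_one]

lemma cond_le (q : ℝ) (hq : 0 < q) (τ : Platform 2 → ℝ) (h0 : ∀ z, 0 ≤ τ z) (a : Policy)
    (C : Finset (Fin 2)) (S : Narrative 2) : condProb q τ a C S ≤ q := by
  unfold condProb
  apply div_le_of_le_mul₀ (Finset.sum_nonneg fun z _ => h0 z) hq.le
  apply mul_le_mul_of_nonneg_left _ hq.le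
  apply Finset.sum_le_sum_of_subset_of_nonneg
  · intro z
    simp only [Finset.mem_filter]
    tauto
  · intro z _ _
    exact h0 z

lemma adm (f : Fin 2 → Policy → ℝ) (a : Policy) (i : Fin 2) (h : 0 < f i a) :
    Admissible f a {i} := by
  refine ⟨by simp, ?_, by simpa using h⟩
  revert i
  intro i _
  fin_cases i <;> decide

/-- Single-step exclusion. -/
lemma step (q : ℝ) (hq0 : 0 < q)
    (f : Fin 2 → Policy → ℝ) (hnn : ∀ i a, 0 ≤ f i a)
    (hh : f 1 Policy.h < f 0 Policy.h) (hl : f 0 Policy.l < f 1 Policy.l)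
    (ε : ℝ) (hε : 0 < ε) (τ : Platform 2 → ℝ) (hτ : EpsEquilibrium q f twoFeas ε τ)
    (ht : ε < τ (Policy.l, ({0} : Finset (Fin 2)), tribalNarr)) :
    sM1 τ * sH τ * f 1 Policy.l ≤ sH1 τ * f 0 Policy.l ∧
    f 0 Policy.h * sM1 τ ≤ sH1 τ * f 0 Policy.l ∧
    ∀ z : Platform 2, (0 : Fin 2) ∉ z.2.1 → z ≠ (Policy.l, {1}, denialNarr 2) → τ z ≤ ε := by
  obtain ⟨⟨h0, hs⟩, hv, hopt⟩ := hτ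
  have hf0h : 0 < f 0 Policy.h := (hnn _ _).trans_lt hh
  have hf1l : 0 < f 1 Policy.l := (hnn _ _).trans_lt hl
  have hTv := (hv _).1 (hε.trans ht)
  have hmax := hopt _ hTv ht
  have vht : Valid f twoFeas (Policy.h, {0}, trueNarr 2) := ⟨adm f _ _ hf0h, Or.inl rfl⟩
  have vld : Valid f twoFeas (Policy.l, {1}, denialNarr 2) :=
    ⟨adm f _ _ hf1l, Or.inr (Or.inl rfl)⟩
  have hM1 : 0 < sM1 τ := by
    refine Finset.sum_pos' (fun z _ => ?_) ⟨(Policy.l, {0}, tribalNarr), Finset.mem_univ _, ?_⟩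
    · split_ifs
      exacts [h0 z, le_rfl]
    · simpa using hε.trans ht
  have hH : 0 < sH τ := by
    refine Finset.sum_pos' (fun z _ => ?_) ⟨(Policy.h, {0}, trueNarr 2), Finset.mem_univ _, ?_⟩
    · split_ifs
      exacts [h0 z, le_rfl]
    · simpa using (hv _).2 vht
  have e1 := hmax _ vld
  have e2 := hmax _ vht
  have E2 := e2
  rw [pay_t1, pay_d _ _ _ hs] at e1
  rw [pay_t1, pay_ht _ _ _ _ hH] at e2
  have k1 : sM1 τ * sH τ * f 1 Policy.l ≤ sH1 τ * f 0 Policy.l := by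
    rw [mul_div_assoc, mul_assoc, mul_assoc, mul_le_mul_iff_right₀ hq0, div_mul_eq_mul_div,
      le_div_iff₀ hM1] at e1
    linarith
  have k2 : f 0 Policy.h * sM1 τ ≤ sH1 τ * f 0 Policy.l := by
    rw [mul_div_assoc, mul_assoc, mul_le_mul_iff_right₀ hq0, div_mul_eq_mul_div,
      le_div_iff₀ hM1] at e2
    linarith
  refine ⟨k1, k2, ?_⟩
  rintro ⟨a, C, S⟩ hC hne
  by_contra! hlt
  have hzv := (hv _).1 (hε.trans hlt)
  have hzm := hopt _ hzv hlt
  have hC1 : C = {1} := by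
    obtain ⟨i, hi⟩ := hzv.1.1
    have : (0 : Fin 2) ∉ C := hC
    ext j
    fin_cases j
    · simpa using this
    · have hi' : i ∈ C := hi
      have : i = 1 := by
        fin_cases i
        · exact absurd hi' this
        · rfl
      subst this
      simpa using hi'
  subst hC1
  have m1 := hzm _ vht
  rw [pay_ht _ _ _ _ hH] at m1
  have pos : 0 < q * f 0 Policy.h := mul_pos hq0 hf0h
  cases a with
  | h =>
    have : payoff q f τ (Policy.h, {1}, S) ≤ q * f 1 Policy.h := by
      simp only [payoff, Finset.sum_singleton]
      exact mul_le_mul_of_nonneg_right (cond_le q hq0 τ h0 _ _ _) (hnn _ _)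
    have := mul_lt_mul_of_pos_left hh hq0
    linarith
  | l =>
    rcases hzv.2 with h | h | h
    · simp only at h
      subst h
      rw [pay_lt] at m1
      linarith
    · simp only at h
      subst h
      exact hne rfl
    · simp only at h
      subst h
      have hM2 : 0 < sM2 τ := by
        refine Finset.sum_pos' (fun z _ => ?_)
          ⟨(Policy.l, {1}, tribalNarr), Finset.mem_univ _, ?_⟩
        · split_ifs
          exacts [le_rfl, h0 z]
        · simpa using hε.trans hlt
      have m2 := hzm _ vld
      rw [pay_t2, pay_d _ _ _ hs, mul_le_mul_iff_left₀ hf1l, mul_div_assoc,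
        mul_le_mul_iff_right₀ hq0, le_div_iff₀ hM2] at m2
      have hM := sM_add τ
      rw [hs] at hM
      have hHa := sH_add τ
      have hH1 : 0 < sH1 τ := by
        have : 0 < sH1 τ * f 0 Policy.l := (mul_pos hf0h hM1).trans_le k2
        exact pos_of_mul_pos_left this (hnn _ _)
      have : sM1 τ * sH τ * f 1 Policy.l < sH1 τ * f 1 Policy.l :=
        k1.trans_lt (mul_lt_mul_of_pos_left hl hH1)
      have := lt_of_mul_lt_mul_right this hf1l.le
      have : sH τ * (sM1 τ + sM2 τ) < sH τ := by linarith
      rw [hM] at this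
      linarith

lemma tends (p : Platform 2 → Prop) [DecidablePred p] (σs : ℕ → Platform 2 → ℝ) (σ : Platform 2 → ℝ)
    (h : ∀ z, Filter.Tendsto (fun k => σs k z) Filter.atTop (nhds (σ z))) :
    Filter.Tendsto (fun k => ∑ z, if p z then σs k z else 0) Filter.atTop
      (nhds (∑ z, if p z then σ z else 0)) := by
  refine tendsto_finsetSum _ fun z _ => ?_
  split_ifs
  exacts [h z, tendsto_const_nhds]

end FN

/-- In the two-group model, in any equilibrium `σ`, if
`σ(ℓ,{1},tribal) > 0` then `σ(ℓ,{2},denial) > 0`.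
(Group 1 is index `0`, group 2 is index `1`.) -/
theorem two_group_tribal_needs_denial
    (q : ℝ) (hq0 : 0 < q) (hq1 : q ≤ 1)
    (f : Fin 2 → Policy → ℝ) (hnn : ∀ i a, 0 ≤ f i a)
    (hh : f 1 Policy.h < f 0 Policy.h) (hl : f 0 Policy.l < f 1 Policy.l)
    (σ : Platform 2 → ℝ) (hσ : FN.Equilibrium q f FN.twoFeas σ)
    (htribal : 0 < σ (Policy.l, ({0} : Finset (Fin 2)), FN.tribalNarr)) :
    0 < σ (Policy.l, ({1} : Finset (Fin 2)), FN.denialNarr 2) := by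
  obtain ⟨ε, σs, hε, hε0, heq, hlim⟩ := hσ
  by_contra hcon
  have hf0h : 0 < f 0 Policy.h := (hnn _ _).trans_lt hh
  have ev := hε0.eventually_lt (hlim _) htribal
  have st := fun k hk => FN.step q hq0 f hnn hh hl (ε k) (hε k) (σs k) (heq k) hk
  have hpos : ∀ z, 0 ≤ σ z := fun z => ge_of_tendsto' (hlim z) fun k => (heq k).1.1 z
  have hz : ∀ z : Platform 2, (0 : Fin 2) ∉ z.2.1 → σ z = 0 := by
    intro z hz
    refine le_antisymm ?_ (hpos z)
    by_cases hne : z = (Policy.l, {1}, FN.denialNarr 2)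
    · rw [hne]
      exact not_lt.1 hcon
    · exact le_of_tendsto_of_tendsto (hlim z) hε0 (ev.mono fun k hk => (st k hk).2.2 z hz hne)
  have hsum : ∑ z, σ z = 1 := by
    have h1 := tendsto_finsetSum (Finset.univ : Finset (Platform 2)) fun z _ => hlim z
    refine tendsto_nhds_unique h1 ?_
    simp only [(heq _).1.2]
    exact tendsto_const_nhds
  have hM1 : FN.sM1 σ = 1 := by
    rw [← hsum]
    refine Finset.sum_congr rfl fun z _ => ?_
    split_ifs with h
    exacts [rfl, (hz z h).symm]
  have hH1 : FN.sH1 σ = FN.sH σ := by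
    refine Finset.sum_congr rfl fun z _ => ?_
    by_cases h1 : z.1 = Policy.h <;> by_cases h2 : (0 : Fin 2) ∈ z.2.1
    · simp [h1, h2]
    · simp [h1, h2, hz z h2]
    · simp [h1]
    · simp [h1]
  have tM : Filter.Tendsto (fun k => FN.sM1 (σs k)) Filter.atTop (nhds (FN.sM1 σ)) :=
    FN.tends (fun z => (0 : Fin 2) ∈ z.2.1) σs σ hlim
  have tH : Filter.Tendsto (fun k => FN.sH (σs k)) Filter.atTop (nhds (FN.sH σ)) := by
    simpa only [FN.sH] using FN.tends (fun z => z.1 = Policy.h) σs σ hlim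
  have tH1 : Filter.Tendsto (fun k => FN.sH1 (σs k)) Filter.atTop (nhds (FN.sH1 σ)) := by
    simpa only [FN.sH1] using
      FN.tends (fun z => z.1 = Policy.h ∧ (0 : Fin 2) ∈ z.2.1) σs σ hlim
  have l1 := le_of_tendsto_of_tendsto ((tM.mul tH).mul_const (f 1 Policy.l))
    (tH1.mul_const (f 0 Policy.l)) (ev.mono fun k hk => (st k hk).1)
  have l2 := le_of_tendsto_of_tendsto (tM.const_mul (f 0 Policy.h))
    (tH1.mul_const (f 0 Policy.l)) (ev.mono fun k hk => (st k hk).2.1)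
  rw [hM1, hH1] at l1 l2
  have hHp : 0 < FN.sH σ := by
    have : 0 < FN.sH σ * f 0 Policy.l := by linarith
    exact pos_of_mul_pos_left this (hnn _ _)
  have := mul_lt_mul_of_pos_left hl hHp
  linarith
end

section
/- In the two-group model, if f_2(ℓ)>f_1(ℓ)>f_1(h), then the unique equilibrium is σ(h,{1},true)=f_1(h)/f_2(ℓ), σ(ℓ,{2},denial)=(f_2(ℓ)−f_1(ℓ))/f_2(ℓ), and σ(ℓ,{1},tribal)=(f_1(ℓ)−f_1(h))/f_2(ℓ), and all three platforms in its support attain the common payoff q·f_1(h). -/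
open Finset
open scoped Classical

/-- The candidate equilibrium of Case II(b): mass `f₁(h)/f₂(ℓ)` on `(h,{1},true)`,
mass `(f₂(ℓ) - f₁(ℓ))/f₂(ℓ)` on `(ℓ,{2},denial)`, mass `(f₁(ℓ) - f₁(h))/f₂(ℓ)` on
`(ℓ,{1},tribal)`, and zero elsewhere. -/
noncomputable def eqCaseIIb (f : Fin 2 → Policy → ℝ) : Platform 2 → ℝ := fun z =>
  if z = ((Policy.h, ({0} : Finset (Fin 2)), FN.trueNarr 2) : Platform 2) then
    f 0 Policy.h / f 1 Policy.l
  else if z = ((Policy.l, ({1} : Finset (Fin 2)), FN.denialNarr 2) : Platform 2) then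
    (f 1 Policy.l - f 0 Policy.l) / f 1 Policy.l
  else if z = ((Policy.l, ({0} : Finset (Fin 2)), FN.tribalNarr) : Platform 2) then
    (f 0 Policy.l - f 0 Policy.h) / f 1 Policy.l
  else 0

namespace FN

def Supp2 (σ : Platform 2 → ℝ) : Prop :=
  ∀ z, σ z ≠ 0 → (z.2.1 = {0} ∨ z.2.1 = {1}) ∧ twoFeas z.2.2

def M (σ : Platform 2 → ℝ) (a : Policy) (i : Fin 2) : ℝ :=
  σ (a, {i}, trueNarr 2) + σ (a, {i}, denialNarr 2) + σ (a, {i}, tribalNarr)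

lemma sum_T (g : Platform 2 → ℝ) (hg : Supp2 g) :
    ∑ z, g z = M g Policy.l 0 + M g Policy.l 1 + M g Policy.h 0 + M g Policy.h 1 := by
  have h : ∑ z ∈ (({Policy.l, Policy.h} : Finset Policy) ×ˢ
      ((({{0}, {1}} : Finset (Finset (Fin 2))) ×ˢ
        ({trueNarr 2, denialNarr 2, tribalNarr} : Finset (Narrative 2))))), g z = ∑ z, g z := by
    apply Finset.sum_subset (Finset.subset_univ _)
    rintro ⟨a, C, S⟩ - hz
    by_contra hne
    obtain ⟨h1, h2⟩ := hg _ hne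
    apply hz
    simp only [twoFeas] at h1 h2
    simp only [Finset.mem_product, Finset.mem_insert, Finset.mem_singleton]
    exact ⟨by cases a <;> simp, h1, h2⟩
  have e1 : ({0} : Finset (Fin 2)) ∉ ({{1}} : Finset (Finset (Fin 2))) := by decide
  have e2 : trueNarr 2 ∉ ({denialNarr 2, tribalNarr} : Finset (Narrative 2)) := by decide
  have e3 : denialNarr 2 ∉ ({tribalNarr} : Finset (Narrative 2)) := by decide
  have e4 : Policy.l ∉ ({Policy.h} : Finset Policy) := by decide
  rw [← h]
  simp only [Finset.sum_product, Finset.sum_insert e1, Finset.sum_insert e2, Finset.sum_insert e3,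
    Finset.sum_insert e4, Finset.sum_singleton, M]
  ring

lemma sum_T_filter (σ : Platform 2 → ℝ) (hg : Supp2 σ) (P : Platform 2 → Prop)
    [DecidablePred P] :
    ∑ z ∈ univ.filter P, σ z =
      M (fun z => if P z then σ z else 0) Policy.l 0 + M (fun z => if P z then σ z else 0) Policy.l 1
      + M (fun z => if P z then σ z else 0) Policy.h 0
      + M (fun z => if P z then σ z else 0) Policy.h 1 := by
  rw [Finset.sum_filter, sum_T]
  intro z hz
  apply hg
  intro h
  simp [h] at hz

lemma pay_h_true (q : ℝ) (f : Fin 2 → Policy → ℝ) (σ : Platform 2 → ℝ) (hg : Supp2 σ) (i : Fin 2)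
    (h : 0 < M σ Policy.h 0 + M σ Policy.h 1) :
    payoff q f σ (Policy.h, {i}, trueNarr 2) = q * f i Policy.h := by
  simp only [payoff, condProb, sum_T_filter σ hg, Finset.sum_singleton]
  simp [M, Agrees, trueNarr] at h ⊢
  left
  field_simp

lemma pay_l_true (q : ℝ) (f : Fin 2 → Policy → ℝ) (σ : Platform 2 → ℝ) (hg : Supp2 σ) (i : Fin 2) :
    payoff q f σ (Policy.l, {i}, trueNarr 2) = 0 := by
  simp only [payoff, condProb, sum_T_filter σ hg, Finset.sum_singleton]
  simp [M, Agrees, trueNarr]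

lemma pay_denial (q : ℝ) (f : Fin 2 → Policy → ℝ) (σ : Platform 2 → ℝ) (hg : Supp2 σ) (i : Fin 2)
    (a : Policy) (h1 : ∑ z, σ z = 1) :
    payoff q f σ (a, {i}, denialNarr 2) = q * (M σ Policy.h 0 + M σ Policy.h 1) * f i a := by
  rw [sum_T σ hg] at h1
  simp only [payoff, condProb, sum_T_filter σ hg, Finset.sum_singleton]
  simp [M, Agrees, denialNarr] at h1 ⊢
  rw [h1]; simp

lemma pay_tribal0 (q : ℝ) (f : Fin 2 → Policy → ℝ) (σ : Platform 2 → ℝ) (hg : Supp2 σ)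
    (a : Policy) :
    payoff q f σ (a, {0}, tribalNarr) =
      q * M σ Policy.h 0 / (M σ Policy.h 0 + M σ Policy.l 0) * f 0 a := by
  simp only [payoff, condProb, sum_T_filter σ hg, Finset.sum_singleton]
  simp [M, Agrees, tribalNarr, add_comm]

lemma pay_tribal1 (q : ℝ) (f : Fin 2 → Policy → ℝ) (σ : Platform 2 → ℝ) (hg : Supp2 σ)
    (a : Policy) :
    payoff q f σ (a, {1}, tribalNarr) =
      q * M σ Policy.h 1 / (M σ Policy.h 1 + M σ Policy.l 1) * f 1 a := by
  simp only [payoff, condProb, sum_T_filter σ hg, Finset.sum_singleton]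
  simp [M, Agrees, tribalNarr, add_comm]

lemma adm_coal {f : Fin 2 → Policy → ℝ} {a : Policy} {C : Finset (Fin 2)}
    (h : Admissible f a C) : C = {0} ∨ C = {1} := by
  obtain ⟨h1, h2, -⟩ := h
  revert h1 h2
  revert C
  decide

lemma valid_iff {f : Fin 2 → Policy → ℝ} {a : Policy} {i : Fin 2} {S : Narrative 2} (hS : twoFeas S) :
    Valid f twoFeas (a, {i}, S) ↔ 0 < f i a := by
  have : ({i} : Finset (Fin 2)) ≠ univ := by revert i; decide
  simp [Valid, Admissible, hS, this]

lemma feas_t : twoFeas (trueNarr 2) := Or.inl rfl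
lemma feas_d : twoFeas (denialNarr 2) := Or.inr (Or.inl rfl)
lemma feas_b : twoFeas tribalNarr := Or.inr (Or.inr rfl)

lemma valid_cases {f : Fin 2 → Policy → ℝ} {z : Platform 2} (h : Valid f twoFeas z) :
    ∃ a i S, z = (a, {i}, S) ∧ 0 < f i a ∧ twoFeas S := by
  obtain ⟨a, C, S⟩ := z
  have hS : twoFeas S := h.2
  rcases adm_coal h.1 with h' | h' <;> simp only at h' <;> subst h'
  · exact ⟨a, 0, S, rfl, (valid_iff hS).1 h, hS⟩
  · exact ⟨a, 1, S, rfl, (valid_iff hS).1 h, hS⟩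

lemma supp_of_valid {f : Fin 2 → Policy → ℝ} {σ : Platform 2 → ℝ}
    (h : ∀ z, σ z ≠ 0 → Valid f twoFeas z) : Supp2 σ :=
  fun z hz => ⟨adm_coal (h z hz).1, (h z hz).2⟩

def Opt (q : ℝ) (f : Fin 2 → Policy → ℝ) (σ : Platform 2 → ℝ) (z : Platform 2) : Prop :=
  ∀ z', Valid f twoFeas z' → payoff q f σ z' ≤ payoff q f σ z

/-- Facts about an optimal platform against a full support distribution. -/
lemma opt_facts (q : ℝ) (hq0 : 0 < q)
    (f : Fin 2 → Policy → ℝ) (hnn : ∀ i a, 0 ≤ f i a)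
    (hh : f 1 Policy.h < f 0 Policy.h) (hl : f 0 Policy.l < f 1 Policy.l)
    (hcase : f 0 Policy.h < f 0 Policy.l) (σ : Platform 2 → ℝ)
    (h1 : IsDist σ) (h2 : ∀ z, 0 < σ z ↔ Valid f twoFeas z) :
    (∀ i S, twoFeas S → Opt q f σ (Policy.h, {i}, S) → i = 0 ∧ S = trueNarr 2) ∧
    (∀ i, ¬ Opt q f σ (Policy.l, {i}, trueNarr 2)) ∧
    (¬ Opt q f σ (Policy.l, {0}, denialNarr 2)) ∧
    (Opt q f σ (Policy.h, {0}, trueNarr 2) →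
      (M σ Policy.h 0 + M σ Policy.h 1) * f 1 Policy.l ≤ f 0 Policy.h ∧
      M σ Policy.h 0 * f 0 Policy.l ≤ f 0 Policy.h * (M σ Policy.h 0 + M σ Policy.l 0)) ∧
    (Opt q f σ (Policy.l, {1}, denialNarr 2) →
      f 0 Policy.h ≤ (M σ Policy.h 0 + M σ Policy.h 1) * f 1 Policy.l) ∧
    (Opt q f σ (Policy.l, {0}, tribalNarr) →
      f 0 Policy.h * (M σ Policy.h 0 + M σ Policy.l 0) ≤ M σ Policy.h 0 * f 0 Policy.l) ∧
    (Opt q f σ (Policy.l, {1}, tribalNarr) →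
      f 0 Policy.h * (M σ Policy.h 1 + M σ Policy.l 1) ≤ M σ Policy.h 1 * f 1 Policy.l) := by
  have hs : Supp2 σ := supp_of_valid (f := f) (fun z hz => (h2 z).1 (lt_of_le_of_ne (h1.1 z) hz.symm))
  have b0 := hnn 1 Policy.h
  have a0 : 0 < f 0 Policy.h := lt_of_le_of_lt b0 hh
  have c0 : 0 < f 0 Policy.l := a0.trans hcase
  have d0 : 0 < f 1 Policy.l := c0.trans hl
  have pos : ∀ a i, 0 < f i a → 0 < M σ a i := fun a i hp => by
    have x1 := (h2 (a, {i}, trueNarr 2)).2 ((valid_iff feas_t).2 hp)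
    have x2 := (h2 (a, {i}, denialNarr 2)).2 ((valid_iff feas_d).2 hp)
    have x3 := (h2 (a, {i}, tribalNarr)).2 ((valid_iff feas_b).2 hp)
    simp only [M]; positivity
  have A0 := pos Policy.h 0 a0
  have C0 := pos Policy.l 0 c0
  have D0 := pos Policy.l 1 d0
  have B0 : 0 ≤ M σ Policy.h 1 := by
    simp only [M]; have := h1.1; exact add_nonneg (add_nonneg (this _) (this _)) (this _)
  have tot := h1.2
  rw [sum_T σ hs] at tot
  have v1 : Valid f twoFeas (Policy.h, {0}, trueNarr 2) := (valid_iff feas_t).2 a0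
  have v2 : Valid f twoFeas (Policy.l, {1}, denialNarr 2) := (valid_iff feas_d).2 d0
  have v3 : Valid f twoFeas (Policy.l, {0}, tribalNarr) := (valid_iff feas_b).2 c0
  have P1 := pay_h_true q f σ hs 0 (by positivity)
  have P1' := pay_h_true q f σ hs 1 (by positivity)
  have P2 := fun i => pay_l_true q f σ hs i
  have P3 := fun i a => pay_denial q f σ hs i a h1.2
  have P4 := fun a => pay_tribal0 q f σ hs a
  have P5 := fun a => pay_tribal1 q f σ hs a
  generalize M σ Policy.h 0 = A at *
  generalize M σ Policy.h 1 = B at *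
  generalize M σ Policy.l 0 = C at *
  generalize M σ Policy.l 1 = D at *
  have hAC : A / (A + C) < 1 := by rw [div_lt_one (by positivity)]; linarith
  have hBD : B / (B + D) < 1 := by rw [div_lt_one (by positivity)]; linarith
  have hBD0 : 0 ≤ B / (B + D) := by positivity
  refine ⟨?_, ?_, ?_, ?_, ?_, ?_, ?_⟩
  · rintro i S (rfl | rfl | rfl) h
    · refine ⟨?_, rfl⟩
      fin_cases i
      · rfl
      · exfalso
        have := h _ v1
        simp only [Fin.mk_one, P1, P1'] at this
        have := le_of_mul_le_mul_left this hq0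
        linarith
    · exfalso
      have := h _ v1
      rw [P1, P3, mul_assoc] at this
      have := le_of_mul_le_mul_left this hq0
      have : f i Policy.h ≤ f 0 Policy.h := by fin_cases i <;> simp [hh.le]
      nlinarith
    · exfalso
      have := h _ v1
      fin_cases i
      · simp only [Fin.zero_eta, P1, P4, mul_div_assoc, mul_assoc] at this
        have := le_of_mul_le_mul_left this hq0
        nlinarith
      · simp only [Fin.mk_one, P1, P5, mul_div_assoc, mul_assoc] at this
        have := le_of_mul_le_mul_left this hq0
        nlinarith
  · intro i h
    have := h _ v1
    rw [P1, P2] at this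
    nlinarith
  · intro h
    have := h _ v2
    rw [P3, P3] at this
    have := le_of_mul_le_mul_left this (by positivity)
    linarith
  · intro h
    have x := h _ v2
    have y := h _ v3
    rw [P1, P3, mul_assoc] at x
    rw [P1, P4, mul_div_assoc, mul_assoc] at y
    have x := le_of_mul_le_mul_left x hq0
    have y := le_of_mul_le_mul_left y hq0
    rw [div_mul_eq_mul_div, div_le_iff₀ (by positivity)] at y
    exact ⟨x, y⟩
  · intro h
    have x := h _ v1
    rw [P1, P3, mul_assoc] at x
    exact le_of_mul_le_mul_left x hq0
  · intro h
    have y := h _ v1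
    rw [P1, P4, mul_div_assoc, mul_assoc] at y
    have y := le_of_mul_le_mul_left y hq0
    rwa [div_mul_eq_mul_div, le_div_iff₀ (by positivity)] at y
  · intro h
    have y := h _ v1
    rw [P1, P5, mul_div_assoc, mul_assoc] at y
    have y := le_of_mul_le_mul_left y hq0
    rwa [div_mul_eq_mul_div, le_div_iff₀ (by positivity)] at y

lemma supp_eq (f : Fin 2 → Policy → ℝ) : Supp2 (eqCaseIIb f) := by
  intro z hz
  unfold eqCaseIIb at hz
  split_ifs at hz with e1 e2 e3
  · subst e1; exact ⟨Or.inl rfl, feas_t⟩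
  · subst e2; exact ⟨Or.inr rfl, feas_d⟩
  · subst e3; exact ⟨Or.inl rfl, feas_b⟩
  · exact absurd rfl hz

lemma narr_ne : (trueNarr 2 ≠ denialNarr 2) ∧ (trueNarr 2 ≠ tribalNarr) ∧ (denialNarr 2 ≠ tribalNarr)
    ∧ (denialNarr 2 ≠ trueNarr 2) ∧ (tribalNarr ≠ trueNarr 2) ∧ (tribalNarr ≠ denialNarr 2) := by
  decide

lemma supp_ext {σ τ : Platform 2 → ℝ} (h1 : Supp2 σ) (h2 : Supp2 τ)
    (h : ∀ a i S, twoFeas S → σ (a, {i}, S) = τ (a, {i}, S)) : σ = τ := by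
  funext z
  by_cases hz : (z.2.1 = {0} ∨ z.2.1 = {1}) ∧ twoFeas z.2.2
  · obtain ⟨a, C, S⟩ := z
    obtain ⟨h' | h', hS⟩ := hz <;> simp only at h' hS <;> subst h' <;> exact h _ _ _ hS
  · rw [not_not.1 fun e => hz (h1 z e), not_not.1 fun e => hz (h2 z e)]

open Filter Topology in
lemma unique_eq (q : ℝ) (hq0 : 0 < q)
    (f : Fin 2 → Policy → ℝ) (hnn : ∀ i a, 0 ≤ f i a)
    (hh : f 1 Policy.h < f 0 Policy.h) (hl : f 0 Policy.l < f 1 Policy.l)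
    (hcase : f 0 Policy.h < f 0 Policy.l) (σ : Platform 2 → ℝ)
    (h : Equilibrium q f twoFeas σ) : σ = eqCaseIIb f := by
  obtain ⟨ε, τ, hε, hε0, hτ, hlim⟩ := h
  have a0 : 0 < f 0 Policy.h := lt_of_le_of_lt (hnn 1 Policy.h) hh
  have c0 : 0 < f 0 Policy.l := a0.trans hcase
  have d0 : 0 < f 1 Policy.l := c0.trans hl
  have F := fun k => opt_facts q hq0 f hnn hh hl hcase (τ k) (hτ k).1 (hτ k).2.1
  have hnnσ : ∀ z, 0 ≤ σ z := fun z => ge_of_tendsto' (hlim z) fun k => (hτ k).1.1 z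
  have hinv : ∀ z, ¬ Valid f twoFeas z → σ z = 0 := fun z hz => by
    refine le_antisymm (le_of_tendsto' (hlim z) fun k => ?_) (hnnσ z)
    by_contra hc
    exact hz (((hτ k).2.1 z).1 (not_le.1 hc))
  have hs : Supp2 σ := supp_of_valid (f := f) fun z hz => by
    by_contra hc
    exact hz (hinv z hc)
  have hsum : ∑ z, σ z = 1 :=
    tendsto_nhds_unique (tendsto_finsetSum _ fun z _ => hlim z) (by simp [(hτ _).1.2])
  have hM : ∀ a i, Tendsto (fun k => M (τ k) a i) atTop (𝓝 (M σ a i)) := fun a i =>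
    ((hlim _).add (hlim _)).add (hlim _)
  have hopt : ∀ z, 0 < σ z → ∀ᶠ k in atTop, Opt q f (τ k) z := fun z hz => by
    filter_upwards [hε0.eventually_lt (hlim z) hz] with k hk
    exact (hτ k).2.2 z (((hτ k).2.1 z).1 ((hε k).trans hk)) hk
  have hno : ∀ z, (∀ k, ¬ Opt q f (τ k) z) → σ z = 0 := fun z hz => by
    by_contra hc
    obtain ⟨k, hk⟩ := (hopt z (lt_of_le_of_ne (hnnσ z) (Ne.symm hc))).exists
    exact hz k hk
  have Z1 : ∀ i S, twoFeas S → ¬ (i = 0 ∧ S = trueNarr 2) → σ (Policy.h, {i}, S) = 0 :=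
    fun i S hS hn => hno _ fun k hk => hn ((F k).1 i S hS hk)
  have Z2 : ∀ i, σ (Policy.l, {i}, trueNarr 2) = 0 := fun i => hno _ fun k hk => (F k).2.1 i hk
  have Z3 : σ (Policy.l, {0}, denialNarr 2) = 0 := hno _ fun k hk => (F k).2.2.1 hk
  have I1 : 0 < σ (Policy.h, {0}, trueNarr 2) → 
      (M σ Policy.h 0 + M σ Policy.h 1) * f 1 Policy.l ≤ f 0 Policy.h ∧
      M σ Policy.h 0 * f 0 Policy.l ≤ f 0 Policy.h * (M σ Policy.h 0 + M σ Policy.l 0) := fun hz =>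
    ⟨le_of_tendsto (((hM _ _).add (hM _ _)).mul_const _)
      ((hopt _ hz).mono fun k hk => ((F k).2.2.2.1 hk).1),
     le_of_tendsto_of_tendsto ((hM _ _).mul_const _) (((hM _ _).add (hM _ _)).const_mul _)
      ((hopt _ hz).mono fun k hk => ((F k).2.2.2.1 hk).2)⟩
  have I2 : 0 < σ (Policy.l, {1}, denialNarr 2) →
      f 0 Policy.h ≤ (M σ Policy.h 0 + M σ Policy.h 1) * f 1 Policy.l := fun hz =>
    ge_of_tendsto (((hM _ _).add (hM _ _)).mul_const _)
      ((hopt _ hz).mono fun k hk => ((F k).2.2.2.2.1 hk))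
  have I3 : 0 < σ (Policy.l, {0}, tribalNarr) →
      f 0 Policy.h * (M σ Policy.h 0 + M σ Policy.l 0) ≤ M σ Policy.h 0 * f 0 Policy.l := fun hz =>
    le_of_tendsto_of_tendsto (((hM _ _).add (hM _ _)).const_mul _) ((hM _ _).mul_const _)
      ((hopt _ hz).mono fun k hk => ((F k).2.2.2.2.2.1 hk))
  have I4 : 0 < σ (Policy.l, {1}, tribalNarr) →
      f 0 Policy.h * (M σ Policy.h 1 + M σ Policy.l 1) ≤ M σ Policy.h 1 * f 1 Policy.l := fun hz =>
    le_of_tendsto_of_tendsto (((hM _ _).add (hM _ _)).const_mul _) ((hM _ _).mul_const _)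
      ((hopt _ hz).mono fun k hk => ((F k).2.2.2.2.2.2 hk))
  obtain ⟨n1, n2, n3, n4, n5, n6⟩ := narr_ne
  have z1 := Z1 0 _ feas_d (by simp [n4])
  have z2 := Z1 0 _ feas_b (by simp [n5])
  have z3 := Z1 1 _ feas_t (by simp)
  have z4 := Z1 1 _ feas_d (by simp)
  have z5 := Z1 1 _ feas_b (by simp)
  rw [sum_T σ hs] at hsum
  simp only [M, z1, z2, z3, z4, z5, Z2, Z3, add_zero, zero_add] at hsum I1 I2 I3 I4
  have p0 := hnnσ (Policy.h, {0}, trueNarr 2)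
  have r0 := hnnσ (Policy.l, {0}, tribalNarr)
  have s0 := hnnσ (Policy.l, {1}, denialNarr 2)
  have t0 := hnnσ (Policy.l, {1}, tribalNarr)
  obtain ⟨p, hp⟩ : ∃ p, σ (Policy.h, {0}, trueNarr 2) = p := ⟨_, rfl⟩
  obtain ⟨r, hr⟩ : ∃ p, σ (Policy.l, {0}, tribalNarr) = p := ⟨_, rfl⟩
  obtain ⟨s, hs'⟩ : ∃ p, σ (Policy.l, {1}, denialNarr 2) = p := ⟨_, rfl⟩
  obtain ⟨t, ht⟩ : ∃ p, σ (Policy.l, {1}, tribalNarr) = p := ⟨_, rfl⟩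
  rw [hp] at p0; rw [hr] at r0; rw [hs'] at s0; rw [ht] at t0
  simp only [hp, hr, hs', ht] at hsum I1 I2 I3 I4
  have ht0 : t = 0 := by
    by_contra hc
    have := I4 (lt_of_le_of_ne t0 (Ne.symm hc))
    have : 0 < t := lt_of_le_of_ne t0 (Ne.symm hc)
    nlinarith
  have pp : 0 < p := by
    by_contra hc
    have : p = 0 := le_antisymm (not_lt.1 hc) p0
    subst this
    have : s = 0 := by
      by_contra hc
      have := I2 (lt_of_le_of_ne s0 (Ne.symm hc))
      linarith
    have hr1 : r = 1 := by linarith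
    subst hr1
    have := I3 one_pos
    linarith
  obtain ⟨J1, J2⟩ := I1 pp
  have rp : 0 < r := by
    by_contra hc
    have : r = 0 := le_antisymm (not_lt.1 hc) r0
    subst this
    nlinarith
  have J3 := I3 rp
  have sp : 0 < s := by
    by_contra hc
    have : s = 0 := le_antisymm (not_lt.1 hc) s0
    subst this
    have : p + r = 1 := by linarith
    rw [this] at J3
    nlinarith
  have J4 := I2 sp
  have E1 : p * f 1 Policy.l = f 0 Policy.h := le_antisymm J1 J4
  have E2 : f 0 Policy.h * (p + r) = p * f 0 Policy.l := le_antisymm J3 J2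
  have E3 : (p + r) * f 1 Policy.l = f 0 Policy.l := by
    rw [← E1] at E2
    have : p * ((p + r) * f 1 Policy.l) = p * f 0 Policy.l := by linarith
    exact mul_left_cancel₀ pp.ne' this
  have E4 : s * f 1 Policy.l = f 1 Policy.l - f 0 Policy.l := by
    have : s = 1 - (p + r) := by linarith
    rw [this, sub_mul, E3, one_mul]
  apply supp_ext hs (supp_eq f)
  have ne01 : ({0} : Finset (Fin 2)) ≠ {1} := by decide
  have ne10 : ({1} : Finset (Fin 2)) ≠ {0} := by decide
  rintro a i S (rfl | rfl | rfl) <;> cases a <;> fin_cases i <;>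
    simp [eqCaseIIb, n1, n2, n3, n4, n5, n6, z1, z2, z3, z4, z5, Z2, Z3, hp, hr, hs', ht, ht0] <;>
    field_simp <;> linarith

lemma M_eq (f : Fin 2 → Policy → ℝ) :
    M (eqCaseIIb f) Policy.h 0 = f 0 Policy.h / f 1 Policy.l ∧
    M (eqCaseIIb f) Policy.h 1 = 0 ∧
    M (eqCaseIIb f) Policy.l 0 = (f 0 Policy.l - f 0 Policy.h) / f 1 Policy.l ∧
    M (eqCaseIIb f) Policy.l 1 = (f 1 Policy.l - f 0 Policy.l) / f 1 Policy.l := by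
  obtain ⟨n1, n2, n3, n4, n5, n6⟩ := narr_ne
  refine ⟨?_, ?_, ?_, ?_⟩ <;> simp [M, eqCaseIIb, n1, n2, n3, n4, n5, n6]

noncomputable def mB (f : Fin 2 → Policy → ℝ) (δ : ℝ) : ℝ := (if 0 < f 1 Policy.h then 3 else 0) * δ
noncomputable def mA (f : Fin 2 → Policy → ℝ) (δ : ℝ) : ℝ := f 0 Policy.h / f 1 Policy.l - mB f δ
noncomputable def mC (f : Fin 2 → Policy → ℝ) (δ : ℝ) : ℝ :=
  mA f δ * ((f 0 Policy.l - f 0 Policy.h) / f 0 Policy.h)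
noncomputable def mD (f : Fin 2 → Policy → ℝ) (δ : ℝ) : ℝ :=
  1 - f 0 Policy.h / f 1 Policy.l - mC f δ

noncomputable def sg (f : Fin 2 → Policy → ℝ) (δ : ℝ) : Platform 2 → ℝ := fun z =>
  if z = ((Policy.h, ({0} : Finset (Fin 2)), FN.trueNarr 2) : Platform 2) then
    mA f δ - 2 * δ
  else if z = ((Policy.l, ({1} : Finset (Fin 2)), FN.denialNarr 2) : Platform 2) then
    mD f δ - 2 * δ
  else if z = ((Policy.l, ({0} : Finset (Fin 2)), FN.tribalNarr) : Platform 2) then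
    mC f δ - 2 * δ
  else if Valid f twoFeas z then δ else 0

lemma M_sg (f : Fin 2 → Policy → ℝ) (δ : ℝ) (a0 : 0 < f 0 Policy.h) (c0 : 0 < f 0 Policy.l)
    (d0 : 0 < f 1 Policy.l) :
    M (sg f δ) Policy.h 0 = mA f δ ∧ M (sg f δ) Policy.h 1 = mB f δ ∧
    M (sg f δ) Policy.l 0 = mC f δ ∧ M (sg f δ) Policy.l 1 = mD f δ := by
  obtain ⟨n1, n2, n3, n4, n5, n6⟩ := narr_ne
  refine ⟨?_, ?_, ?_, ?_⟩
  · simp [M, sg, n1, n2, n3, n4, n5, n6, valid_iff feas_t, valid_iff feas_d, valid_iff feas_b, a0]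
    ring
  · simp [M, sg, mB, n1, n2, n3, n4, n5, n6, valid_iff feas_t, valid_iff feas_d, valid_iff feas_b]
    split_ifs <;> ring
  · simp [M, sg, n1, n2, n3, n4, n5, n6, valid_iff feas_t, valid_iff feas_d, valid_iff feas_b, c0]
    ring
  · simp [M, sg, n1, n2, n3, n4, n5, n6, valid_iff feas_t, valid_iff feas_d, valid_iff feas_b, d0]
    ring

lemma sg_eps (q : ℝ) (hq0 : 0 < q)
    (f : Fin 2 → Policy → ℝ) (hnn : ∀ i a, 0 ≤ f i a)
    (hh : f 1 Policy.h < f 0 Policy.h) (hl : f 0 Policy.l < f 1 Policy.l)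
    (hcase : f 0 Policy.h < f 0 Policy.l) (δ : ℝ) (hδ : 0 < δ)
    (hA : 0 < mA f δ - 2 * δ) (hC : 0 < mC f δ - 2 * δ) (hD : 0 < mD f δ - 2 * δ)
    (hB : 0 < f 0 Policy.h * mD f δ - mB f δ * (f 1 Policy.l - f 0 Policy.h)) :
    EpsEquilibrium q f twoFeas δ (sg f δ) := by
  have a0 : 0 < f 0 Policy.h := lt_of_le_of_lt (hnn 1 Policy.h) hh
  have c0 : 0 < f 0 Policy.l := a0.trans hcase
  have d0 : 0 < f 1 Policy.l := c0.trans hl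
  obtain ⟨m1, m2, m3, m4⟩ := M_sg f δ a0 c0 d0
  have v1 : Valid f twoFeas (Policy.h, {0}, trueNarr 2) := (valid_iff feas_t).2 a0
  have v2 : Valid f twoFeas (Policy.l, {1}, denialNarr 2) := (valid_iff feas_d).2 d0
  have v3 : Valid f twoFeas (Policy.l, {0}, tribalNarr) := (valid_iff feas_b).2 c0
  have hpos : ∀ z, 0 < sg f δ z ↔ Valid f twoFeas z := by
    intro z
    unfold sg
    split_ifs with e1 e2 e3 e4
    · subst e1; exact ⟨fun _ => v1, fun _ => hA⟩
    · subst e2; exact ⟨fun _ => v2, fun _ => hD⟩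
    · subst e3; exact ⟨fun _ => v3, fun _ => hC⟩
    · exact ⟨fun _ => e4, fun _ => hδ⟩
    · simp [e4]
  have hnn' : ∀ z, 0 ≤ sg f δ z := by
    intro z
    by_cases hv : Valid f twoFeas z
    · exact ((hpos z).2 hv).le
    · have hv' := hv
      unfold sg
      split_ifs with e1 e2 e3
      · exact hA.le
      · exact hD.le
      · exact hC.le
      · exact le_rfl
  have hs : Supp2 (sg f δ) :=
    supp_of_valid (f := f) (fun z hz => (hpos z).1 (lt_of_le_of_ne (hnn' z) hz.symm))
  have hsum : ∑ z, sg f δ z = 1 := by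
    rw [sum_T _ hs, m1, m2, m3, m4, mD, mA]; ring
  have A0 : 0 < mA f δ := by linarith
  have C0 : 0 < mC f δ := by linarith
  have D0 : 0 < mD f δ := by linarith
  have B0 : 0 ≤ mB f δ := by unfold mB; split_ifs <;> linarith
  have hAB : mA f δ + mB f δ = f 0 Policy.h / f 1 Policy.l := by unfold mA; ring
  have hAC : mA f δ / (mA f δ + mC f δ) = f 0 Policy.h / f 0 Policy.l := by
    rw [div_eq_div_iff (by positivity) c0.ne']
    unfold mC
    field_simp
    ring
  have hBD : mB f δ / (mB f δ + mD f δ) ≤ f 0 Policy.h / f 1 Policy.l := by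
    rw [div_le_div_iff₀ (by positivity) d0]
    linarith
  have P1 := fun i => pay_h_true q f _ hs i (by rw [m1, m2]; positivity)
  have P2 := fun i => pay_l_true q f _ hs i
  have P3 := fun i a => pay_denial q f _ hs i a hsum
  have P4 := fun a => pay_tribal0 q f _ hs a
  have P5 := fun a => pay_tribal1 q f _ hs a
  simp only [m1, m2, m3, m4, hAB, mul_div_assoc, hAC] at P3 P4 P5
  have key : ∀ i a, f 0 Policy.h / f 1 Policy.l * f i a ≤ f 0 Policy.h := by
    intro i a
    rw [div_mul_eq_mul_div, div_le_iff₀ d0]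
    apply mul_le_mul_of_nonneg_left _ a0.le
    fin_cases i <;> cases a <;> simp <;> linarith
  have ub : ∀ z, Valid f twoFeas z → payoff q f (sg f δ) z ≤ q * f 0 Policy.h := by
    intro z hz
    obtain ⟨a, i, S, rfl, hp, rfl | rfl | rfl⟩ := valid_cases hz
    · cases a
      · rw [P2]; positivity
      · rw [P1]
        apply mul_le_mul_of_nonneg_left _ hq0.le
        fin_cases i <;> simp <;> linarith
    · rw [P3, mul_assoc]
      exact mul_le_mul_of_nonneg_left (key _ _) hq0.le
    · fin_cases i
      · simp only [Fin.zero_eta]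
        rw [P4, mul_assoc]
        apply mul_le_mul_of_nonneg_left _ hq0.le
        rw [div_mul_eq_mul_div, div_le_iff₀ c0]
        apply mul_le_mul_of_nonneg_left _ a0.le
        cases a <;> linarith
      · simp only [Fin.mk_one]
        rw [P5, mul_assoc]
        apply mul_le_mul_of_nonneg_left _ hq0.le
        exact (mul_le_mul_of_nonneg_right hBD (hnn _ _)).trans (key _ _)
  refine ⟨⟨hnn', hsum⟩, hpos, fun z hz hlt z' hz' => (ub z' hz').trans (le_of_eq ?_)⟩
  unfold sg at hlt
  split_ifs at hlt with e1 e2 e3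
  · subst e1; rw [P1]
  · subst e2; rw [P3]; field_simp
  · subst e3; rw [P4]; field_simp
  · exact absurd hlt (lt_irrefl _)

open Filter Topology in
lemma exists_eq (q : ℝ) (hq0 : 0 < q)
    (f : Fin 2 → Policy → ℝ) (hnn : ∀ i a, 0 ≤ f i a)
    (hh : f 1 Policy.h < f 0 Policy.h) (hl : f 0 Policy.l < f 1 Policy.l)
    (hcase : f 0 Policy.h < f 0 Policy.l) :
    Equilibrium q f twoFeas (eqCaseIIb f) := by
  have a0 : 0 < f 0 Policy.h := lt_of_le_of_lt (hnn 1 Policy.h) hh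
  have c0 : 0 < f 0 Policy.l := a0.trans hcase
  have d0 : 0 < f 1 Policy.l := c0.trans hl
  have cB : Continuous (mB f) := by unfold mB; fun_prop
  have cA : Continuous (mA f) := by unfold mA; fun_prop
  have cC : Continuous (mC f) := by unfold mC; fun_prop
  have cD : Continuous (mD f) := by unfold mD; fun_prop
  have B0 : mB f 0 = 0 := by simp [mB]
  have A0 : mA f 0 = f 0 Policy.h / f 1 Policy.l := by simp [mA, B0]
  have C0 : mC f 0 = (f 0 Policy.l - f 0 Policy.h) / f 1 Policy.l := by
    rw [mC, A0]; field_simp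
  have D0 : mD f 0 = (f 1 Policy.l - f 0 Policy.l) / f 1 Policy.l := by
    rw [mD, C0]; field_simp; ring
  have pD : 0 < mD f 0 := by rw [D0]; exact div_pos (by linarith) d0
  have ev : ∀ g : ℝ → ℝ, Continuous g → 0 < g 0 → ∀ᶠ δ in 𝓝[>] (0 : ℝ), 0 < g δ := fun g hg h0 =>
    (hg.continuousAt.eventually (lt_mem_nhds h0)).filter_mono nhdsWithin_le_nhds
  have e1 := ev (fun δ => mA f δ - 2 * δ) (by fun_prop) (by simp only [A0]; simp; positivity)
  have e2 := ev (fun δ => mC f δ - 2 * δ) (by fun_prop)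
    (by simp only [C0, mul_zero, sub_zero]; exact div_pos (by linarith) d0)
  have e3 := ev (fun δ => mD f δ - 2 * δ) (by fun_prop) (by simpa using pD)
  have e4 := ev (fun δ => f 0 Policy.h * mD f δ - mB f δ * (f 1 Policy.l - f 0 Policy.h))
    (by fun_prop) (by simp only [B0, zero_mul, sub_zero]; positivity)
  obtain ⟨η, hη, H⟩ := mem_nhdsGT_iff_exists_Ioo_subset.1 (e1.and (e2.and (e3.and e4)))
  have hη : 0 < η := hη
  have t0 : Tendsto (fun k : ℕ => η / 2 * (1 / ((k : ℝ) + 1))) atTop (𝓝 0) := by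
    simpa using tendsto_one_div_add_atTop_nhds_zero_nat.const_mul (η / 2)
  refine ⟨fun k => η / 2 * (1 / ((k : ℝ) + 1)), fun k => sg f (η / 2 * (1 / ((k : ℝ) + 1))),
    fun k => by positivity, t0, fun k => ?_, fun z => ?_⟩
  · have hp : 0 < η / 2 * (1 / ((k : ℝ) + 1)) := by positivity
    have hlt : η / 2 * (1 / ((k : ℝ) + 1)) < η := by
      have : 1 / ((k : ℝ) + 1) ≤ 1 := by
        rw [div_le_one (by positivity)]
        linarith [(Nat.cast_nonneg k : (0 : ℝ) ≤ k)]
      nlinarith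
    obtain ⟨x1, x2, x3, x4⟩ := H ⟨hp, hlt⟩
    exact sg_eps q hq0 f hnn hh hl hcase _ hp x1 x2 x3 x4
  · have hc : Continuous (fun δ => sg f δ z) := by
      unfold sg
      split_ifs <;> fun_prop
    have h0 : sg f 0 z = eqCaseIIb f z := by
      simp only [sg, eqCaseIIb, A0, C0, D0, mul_zero, sub_zero, ite_self]
    rw [← h0]
    exact (hc.tendsto 0).comp t0

end FN

/-- In the two-group model, if `f₂(ℓ) > f₁(ℓ) > f₁(h)`, then the unique
equilibrium is `σ(h,{1},true) = f₁(h)/f₂(ℓ)`,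
`σ(ℓ,{2},denial) = (f₂(ℓ) - f₁(ℓ))/f₂(ℓ)`,
`σ(ℓ,{1},tribal) = (f₁(ℓ) - f₁(h))/f₂(ℓ)`, and all three platforms in its support
attain the common payoff `q·f₁(h)`.  (Group 1 is index `0`, group 2 is index `1`.) -/
theorem two_group_case_IIb
    (q : ℝ) (hq0 : 0 < q) (hq1 : q ≤ 1)
    (f : Fin 2 → Policy → ℝ) (hnn : ∀ i a, 0 ≤ f i a)
    (hh : f 1 Policy.h < f 0 Policy.h) (hl : f 0 Policy.l < f 1 Policy.l)
    (hcase : f 0 Policy.h < f 0 Policy.l) :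
    FN.Equilibrium q f FN.twoFeas (eqCaseIIb f) ∧
    (∀ σ : Platform 2 → ℝ, FN.Equilibrium q f FN.twoFeas σ → σ = eqCaseIIb f) ∧
    FN.payoff q f (eqCaseIIb f)
        (Policy.h, ({0} : Finset (Fin 2)), FN.trueNarr 2) = q * f 0 Policy.h ∧
    FN.payoff q f (eqCaseIIb f)
        (Policy.l, ({1} : Finset (Fin 2)), FN.denialNarr 2) = q * f 0 Policy.h ∧
    FN.payoff q f (eqCaseIIb f)
        (Policy.l, ({0} : Finset (Fin 2)), FN.tribalNarr) = q * f 0 Policy.h := by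
  refine ⟨?_, fun σ h => FN.unique_eq q hq0 f hnn hh hl hcase σ h, ?_⟩
  · exact FN.exists_eq q hq0 f hnn hh hl hcase
  · have a0 : 0 < f 0 Policy.h := lt_of_le_of_lt (hnn 1 Policy.h) hh
    have c0 : 0 < f 0 Policy.l := a0.trans hcase
    have d0 : 0 < f 1 Policy.l := c0.trans hl
    obtain ⟨m1, m2, m3, m4⟩ := FN.M_eq f
    have hs := FN.supp_eq f
    refine ⟨?_, ?_, ?_⟩
    · rw [FN.pay_h_true q f _ hs 0 (by rw [m1, m2]; positivity)]
    · rw [FN.pay_denial q f _ hs 1 _ (by rw [FN.sum_T _ hs, m1, m2, m3, m4]; field_simp; ring), m1, m2]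
      field_simp
      ring
    · rw [FN.pay_tribal0 q f _ hs, m1, m3, ← add_div, add_sub_cancel]
      field_simp
end

section
/- In the fragmented-society model, for every equilibrium σ there exists a platform (a,C,S)∈Supp(σ) with a=h. -/
open Finset
open scoped Classical

open FN in
/-- In the fragmented-society model, for every equilibrium `σ` there
exists a platform `(a,C,S)` in its support with `a = h`. -/
theorem frag_rational_policy_in_support
    (n : ℕ) (q : ℝ) (hq0 : 0 < q) (hq1 : q ≤ 1)
    (f : Fin n → Policy → ℝ) (hf : FN.FOK f)
    (𝒮 : Finset (Finset (Fin n))) (h𝒮 : FN.FamilyOK f 𝒮)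
    (σ : Platform n → ℝ) (hσ : FN.Equilibrium q f (FN.fragFeas 𝒮) σ) :
    ∃ (C : Finset (Fin n)) (S : Narrative n), 0 < σ (Policy.h, C, S) := by
  obtain ⟨ε, σs, hε, hε0, heq, hlim⟩ := hσ
  by_contra hcon
  push Not at hcon
  have hnn : ∀ z, 0 ≤ σ z := fun z =>
    ge_of_tendsto' (hlim z) (fun k => (heq k).1.1 z)
  have hsum : ∑ z, σ z = 1 := by
    have h1 := tendsto_finsetSum (univ : Finset (Platform n)) (fun z _ => hlim z)
    have h2 : (fun k => ∑ z, σs k z) = fun _ => (1 : ℝ) := funext fun k => (heq k).1.2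
    rw [h2] at h1
    exact tendsto_nhds_unique h1 tendsto_const_nhds
  have hh0 : ∀ z : Platform n, z.1 = Policy.h → σ z = 0 := by
    rintro ⟨a, C, S⟩ rfl
    exact le_antisymm (hcon C S) (hnn _)
  obtain ⟨z, hz⟩ : ∃ z, 0 < σ z := by
    by_contra hno
    push Not at hno
    have : ∑ z, σ z ≤ 0 := Finset.sum_nonpos (fun z _ => hno z)
    linarith
  -- the benchmark platform
  obtain ⟨i0, hi0⟩ := hf.2.2 Policy.h
  have hi0m : i0 ∈ Nset f Policy.h := by simp [Nset, hi0]
  set w : Platform n := (Policy.h, Nset f Policy.h, trueNarr n) with hw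
  have hwv : Valid f (fragFeas 𝒮) w := by
    refine ⟨⟨⟨i0, hi0m⟩, ?_, ?_⟩, ?_⟩
    · intro h
      obtain ⟨j, hj⟩ := h𝒮.1
      have h' : Nset f Policy.h = univ := h
      rw [h'] at hj
      simp at hj
    · intro i hi
      exact (Finset.mem_filter.1 hi).2
    · exact h𝒮.2.2.2.2.2.2.1
  have hFpos : 0 < ∑ i ∈ Nset f Policy.h, q * f i Policy.h :=
    Finset.sum_pos (fun i hi => mul_pos hq0 (Finset.mem_filter.1 hi).2) ⟨i0, hi0m⟩
  have hwpay : ∀ k, payoff q f (σs k) w = ∑ i ∈ Nset f Policy.h, q * f i Policy.h := by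
    intro k
    have hc : condProb q (σs k) Policy.h (Nset f Policy.h) (trueNarr n) = q := by
      unfold condProb
      have hfil : (univ.filter (fun z : Platform n =>
          z.1 = Policy.h ∧ Agrees (trueNarr n) Policy.h (Nset f Policy.h) z.1 z.2.1))
          = univ.filter (fun z : Platform n =>
            Agrees (trueNarr n) Policy.h (Nset f Policy.h) z.1 z.2.1) := by
        apply Finset.filter_congr
        intro z _
        exact ⟨fun h => h.2, fun h => ⟨(h.1 rfl).symm, h⟩⟩
      rw [hfil]
      apply mul_div_cancel_right₀
      apply ne_of_gt
      refine Finset.sum_pos' (fun z _ => (heq k).1.1 z) ⟨w, ?_, ((heq k).2.1 w).2 hwv⟩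
      exact Finset.mem_filter.2 ⟨Finset.mem_univ _, fun _ => rfl, fun _ _ => Iff.rfl⟩
    show ∑ i ∈ Nset f Policy.h, _ * _ = _
    simp only [hw, hc]
  -- limit of the payoff of `z`
  have hD : (0:ℝ) < ∑ z' ∈ univ.filter
      (fun z' : Platform n => Agrees z.2.2 z.1 z.2.1 z'.1 z'.2.1), σ z' := by
    refine Finset.sum_pos' (fun z _ => hnn z) ⟨z, ?_, hz⟩
    exact Finset.mem_filter.2 ⟨Finset.mem_univ _, fun _ => rfl, fun _ _ => Iff.rfl⟩
  have hcl : Filter.Tendsto (fun k => condProb q (σs k) z.1 z.2.1 z.2.2) Filter.atTop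
      (nhds (condProb q σ z.1 z.2.1 z.2.2)) := by
    unfold condProb
    exact Filter.Tendsto.div
      ((tendsto_finsetSum _ (fun z _ => hlim z)).const_mul q)
      (tendsto_finsetSum _ (fun z _ => hlim z)) hD.ne'
  have hc0 : condProb q σ z.1 z.2.1 z.2.2 = 0 := by
    unfold condProb
    rw [Finset.sum_eq_zero (fun x hx => hh0 x (Finset.mem_filter.1 hx).2.1)]
    simp
  rw [hc0] at hcl
  have hpl : Filter.Tendsto (fun k => payoff q f (σs k) z) Filter.atTop (nhds 0) := by
    have := tendsto_finsetSum z.2.1 (fun i _ => hcl.mul_const (f i z.1))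
    simpa [payoff] using this
  have hev : ∀ᶠ k in Filter.atTop, ε k < σs k z := hε0.eventually_lt (hlim z) hz
  have hle : (∑ i ∈ Nset f Policy.h, q * f i Policy.h) ≤ 0 := by
    refine ge_of_tendsto hpl ?_
    filter_upwards [hev] with k hk
    rw [← hwpay k]
    exact (heq k).2.2 z (((heq k).2.1 z).1 ((hε k).trans hk)) hk w hwv
  linarith
end

section
/- In the fragmented-society model, in any essential equilibrium σ, the only platform in Supp(σ) with policy a=h is (h,N^h,{0}); consequently, every platform in Supp(σ) attains the common equilibrium payoff U*=q·F(h,N^h). -/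
open Finset
open scoped Classical

namespace FN

variable {n : ℕ}

lemma agrees_self (S : Narrative n) (a : Policy) (C : Finset (Fin n)) : Agrees S a C a C :=
  ⟨fun _ => rfl, fun _ _ => Iff.rfl⟩

/-- Positive mass at `(a,C,T)` makes the conditioning event of `(a,C,S)` non-null. -/
lemma den_pos {σ : Platform n → ℝ} (h0 : ∀ z, 0 ≤ σ z) {a : Policy} {C : Finset (Fin n)}
    {T : Narrative n} (hz : 0 < σ (a, C, T)) (S : Narrative n) :
    0 < ∑ z ∈ univ.filter (fun z : Platform n => Agrees S a C z.1 z.2.1), σ z := by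
  apply Finset.sum_pos' (fun i _ => h0 i)
  exact ⟨(a, C, T), by simp [agrees_self], hz⟩

lemma condProb_le {q : ℝ} (hq : 0 < q) {σ : Platform n → ℝ} (h0 : ∀ z, 0 ≤ σ z) (a : Policy)
    (C : Finset (Fin n)) (S : Narrative n) : condProb q σ a C S ≤ q := by
  unfold condProb
  apply div_le_of_le_mul₀ (Finset.sum_nonneg fun i _ => h0 i) hq.le
  apply mul_le_mul_of_nonneg_left _ hq.le
  apply Finset.sum_le_sum_of_subset_of_nonneg
  · intro z hz
    simp only [Finset.mem_filter] at hz ⊢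
    exact ⟨hz.1, hz.2.2⟩
  · intro i _ _; exact h0 i

lemma condProb_true {q : ℝ} {σ : Platform n → ℝ} (h0 : ∀ z, 0 ≤ σ z)
    {C : Finset (Fin n)} {T : Narrative n} (hz : 0 < σ (Policy.h, C, T)) :
    condProb q σ Policy.h C (trueNarr n) = q := by
  have hd := den_pos h0 hz (trueNarr n)
  unfold condProb
  have : (univ.filter (fun z : Platform n =>
      z.1 = Policy.h ∧ Agrees (trueNarr n) Policy.h C z.1 z.2.1)) =
      univ.filter (fun z : Platform n => Agrees (trueNarr n) Policy.h C z.1 z.2.1) := by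
    apply Finset.filter_congr
    intro z _
    constructor
    · exact fun h => h.2
    · exact fun h => ⟨(h.1 rfl).symm, h⟩
  rw [this]
  field_simp

lemma payoff_eq (q : ℝ) (f : Fin n → Policy → ℝ) (σ : Platform n → ℝ) (a : Policy)
    (C : Finset (Fin n)) (S : Narrative n) :
    payoff q f σ (a, C, S) = condProb q σ a C S * Fval f a C := by
  simp [payoff, Fval, Finset.mul_sum]

lemma payoff_tendsto {q : ℝ} {f : Fin n → Policy → ℝ} {σ : Platform n → ℝ}
    {σs : ℕ → Platform n → ℝ} (h0 : ∀ z, 0 ≤ σ z)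
    (hl : ∀ z, Filter.Tendsto (fun k => σs k z) Filter.atTop (nhds (σ z)))
    {z : Platform n} (hz : 0 < σ z) :
    Filter.Tendsto (fun k => payoff q f (σs k) z) Filter.atTop (nhds (payoff q f σ z)) := by
  obtain ⟨a, C, S⟩ := z
  simp only [payoff_eq]
  apply Filter.Tendsto.mul_const
  unfold condProb
  apply Filter.Tendsto.div
  · exact (tendsto_finsetSum _ fun i _ => hl i).const_mul q
  · exact tendsto_finsetSum _ fun i _ => hl i
  · exact (den_pos h0 hz S).ne'

end FN

/-- In the fragmented-society model, in any essential equilibrium `σ`,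
the only platform in the support of `σ` with policy `a = h` is `(h, N^h, {0})`;
consequently, every platform in the support of `σ` attains the common equilibrium
payoff `U* = q·F(h,N^h)`. -/
theorem frag_common_payoff
    (n : ℕ) (q : ℝ) (hq0 : 0 < q) (hq1 : q ≤ 1)
    (f : Fin n → Policy → ℝ) (hf : FN.FOK f)
    (𝒮 : Finset (Finset (Fin n))) (h𝒮 : FN.FamilyOK f 𝒮)
    (σ : Platform n → ℝ) (hσ : FN.Essential q f (FN.fragFeas 𝒮) σ) :
    (∀ (C : Finset (Fin n)) (S : Narrative n), 0 < σ (Policy.h, C, S) →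
        C = FN.Nset f Policy.h ∧ S = FN.trueNarr n) ∧
    (∀ z : Platform n, 0 < σ z →
        FN.payoff q f σ z = q * FN.Fval f Policy.h (FN.Nset f Policy.h)) := by
  obtain ⟨⟨ε, σs, hε, hε0, heq, hl⟩, hess, -⟩ := hσ
  have h0 : ∀ z, 0 ≤ σ z := fun z =>
    ge_of_tendsto' (hl z) fun k => (heq k).1.1 z
  have hNpos : ∀ i ∈ FN.Nset f Policy.h, 0 < f i Policy.h := fun i hi => by
    simpa [FN.Nset] using hi
  have hNne : (FN.Nset f Policy.h).Nonempty := by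
    obtain ⟨i, hi⟩ := hf.2.2 Policy.h
    exact ⟨i, by simpa [FN.Nset] using hi⟩
  have hF : 0 < FN.Fval f Policy.h (FN.Nset f Policy.h) := Finset.sum_pos hNpos hNne
  have hVal : FN.Valid f (FN.fragFeas 𝒮) (Policy.h, FN.Nset f Policy.h, FN.trueNarr n) := by
    refine ⟨⟨hNne, ?_, hNpos⟩, h𝒮.2.2.2.2.2.2.1⟩
    intro h
    have h1 := h𝒮.1
    change FN.Nset f Policy.h = univ at h
    rw [h] at h1
    simp at h1
  -- supported platforms are eventually valid and optimal
  have hopt : ∀ z, 0 < σ z → ∀ᶠ k in Filter.atTop, FN.Valid f (FN.fragFeas 𝒮) z ∧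
      ∀ z', FN.Valid f (FN.fragFeas 𝒮) z' →
        FN.payoff q f (σs k) z' ≤ FN.payoff q f (σs k) z := by
    intro z hz
    filter_upwards [hε0.eventually_lt (hl z) hz] with k hk
    have hv := ((heq k).2.1 z).1 ((hε k).trans hk)
    exact ⟨hv, (heq k).2.2 z hv hk⟩
  have hge : ∀ z, 0 < σ z →
      q * FN.Fval f Policy.h (FN.Nset f Policy.h) ≤ FN.payoff q f σ z := by
    intro z hz
    apply ge_of_tendsto (FN.payoff_tendsto h0 hl hz)
    filter_upwards [hopt z hz] with k hk
    have := hk.2 _ hVal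
    rwa [FN.payoff_eq, FN.condProb_true (heq k).1.1 (((heq k).2.1 _).2 hVal)] at this
  have part1 : ∀ (C : Finset (Fin n)) (S : Narrative n), 0 < σ (Policy.h, C, S) →
        C = FN.Nset f Policy.h ∧ S = FN.trueNarr n := by
    intro C S hz
    obtain ⟨k, hv, -⟩ := (hopt _ hz).exists
    have hsub : C ⊆ FN.Nset f Policy.h := fun i hi => by
      simpa [FN.Nset] using hv.1.2.2 i hi
    have hCF : 0 ≤ FN.Fval f Policy.h C := Finset.sum_nonneg fun i _ => hf.1 i _
    have hU : FN.payoff q f σ (Policy.h, C, S) ≤ q * FN.Fval f Policy.h C := by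
      rw [FN.payoff_eq]
      exact mul_le_mul_of_nonneg_right (FN.condProb_le hq0 h0 _ _ _) hCF
    have hle := le_of_mul_le_mul_left ((hge _ hz).trans hU) hq0
    constructor
    · by_contra hne
      obtain ⟨i, hi, hiC⟩ := Finset.exists_of_ssubset (hsub.ssubset_of_ne hne)
      exact absurd hle (not_le.2 (Finset.sum_lt_sum_of_subset hsub hi hiC (hNpos i hi)
        fun j _ _ => hf.1 j _))
    · by_contra hne
      have h1 := hess _ _ _ hz hne
      rw [FN.payoff_eq, FN.condProb_true h0 hz] at h1
      linarith
  refine ⟨part1, ?_⟩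
  intro z hz
  apply le_antisymm _ (hge z hz)
  have hex : ∃ w : Platform n, w.1 = Policy.h ∧ 0 < σ w := by
    by_contra hno
    push Not at hno
    have h1 := hge z hz
    obtain ⟨a, C, S⟩ := z
    have hc : FN.condProb q σ a C S = 0 := by
      unfold FN.condProb
      rw [Finset.sum_eq_zero]
      · simp
      · intro w hw
        simp only [Finset.mem_filter] at hw
        exact le_antisymm (hno w hw.2.1) (h0 w)
    rw [FN.payoff_eq, hc, zero_mul] at h1
    exact absurd h1 (not_le.2 (mul_pos hq0 hF))
  obtain ⟨⟨a, C, S⟩, ha, hw⟩ := hex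
  change a = Policy.h at ha
  subst ha
  obtain ⟨rfl, rfl⟩ := part1 C S hw
  have hle : FN.payoff q f σ z ≤
      FN.payoff q f σ (Policy.h, FN.Nset f Policy.h, FN.trueNarr n) := by
    apply le_of_tendsto_of_tendsto (FN.payoff_tendsto h0 hl hz) (FN.payoff_tendsto h0 hl hw)
    filter_upwards [hopt z hz, hopt _ hw] with k h1 h2
    exact h2.2 _ h1.1
  rwa [FN.payoff_eq q f σ Policy.h, FN.condProb_true h0 hw] at hle
end

section
/- In the fragmented-society model, in the unique essential equilibrium, for every feasible narrative S⊆N∖N^h with F(ℓ,S)≥d, where d=F(ℓ,N)−F(h,N), the platform (ℓ,N^ℓ∖S,S) receives zero probability. -/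
open Finset
open scoped Classical

theorem frag_large_scapegoats_unused
    (n : ℕ) (q : ℝ) (hq0 : 0 < q) (hq1 : q ≤ 1)
    (f : Fin n → Policy → ℝ) (hf : FN.FOK f)
    (𝒮 : Finset (Finset (Fin n))) (h𝒮 : FN.FamilyOK f 𝒮)
    (σ : Platform n → ℝ) (hσ : FN.Essential q f (FN.fragFeas 𝒮) σ) :
    ∀ S ∈ 𝒮, S ⊆ univ \ FN.Nset f Policy.h →
      FN.Fval f Policy.l univ - FN.Fval f Policy.h univ ≤ FN.Fval f Policy.l S →
      σ (Policy.l, FN.Nset f Policy.l \ S, ((false, S) : Narrative n)) = 0 := by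
  intro S hS hSsub hd
  obtain ⟨⟨ε, σs, hε, hεt, heq, hlim⟩, -, -⟩ := hσ
  obtain ⟨hf0, hf1, hf2⟩ := hf
  obtain ⟨hne, -, -, -, -, -, hem, -⟩ := h𝒮
  set zs : Platform n := (Policy.l, FN.Nset f Policy.l \ S, ((false, S) : Narrative n)) with hzs
  by_contra hcon
  have hnn : 0 ≤ σ zs := ge_of_tendsto' (hlim zs) (fun k => (heq k).1.1 zs)
  have hpos : 0 < σ zs := lt_of_le_of_ne hnn (Ne.symm hcon)
  obtain ⟨k, hk⟩ := (hεt.eventually_lt (hlim zs) hpos).exists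
  obtain ⟨⟨hs0, -⟩, hval, hmax⟩ := heq k
  have hzpos : 0 < σs k zs := (hε k).trans hk
  have hzval := (hval zs).1 hzpos
  let w : Platform n := (Policy.h, FN.Nset f Policy.h, FN.trueNarr n)
  have hwval : FN.Valid f (FN.fragFeas 𝒮) w := by
    refine ⟨⟨?_, ?_, ?_⟩, hem⟩
    · obtain ⟨i, hi⟩ := hf2 Policy.h
      exact ⟨i, by simp [w, FN.Nset, hi]⟩
    · intro h
      obtain ⟨i, hi⟩ := hne
      have h' : FN.Nset f Policy.h = univ := h
      rw [h'] at hi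
      simp at hi
    · intro i hi
      simpa [w, FN.Nset] using hi
  have hwpos := (hval w).2 hwval
  have hle := hmax zs hzval hk w hwval
  unfold FN.payoff at hle
  rw [← Finset.mul_sum, ← Finset.mul_sum] at hle
  have hcw : FN.condProb q (σs k) w.1 w.2.1 w.2.2 = q := by
    unfold FN.condProb
    have e : (univ.filter (fun z : Platform n =>
        z.1 = Policy.h ∧ FN.Agrees w.2.2 w.1 w.2.1 z.1 z.2.1))
        = univ.filter (fun z : Platform n => FN.Agrees w.2.2 w.1 w.2.1 z.1 z.2.1) := by
      apply Finset.filter_congr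
      intro z _
      constructor
      · exact fun h => h.2
      · exact fun h => ⟨(h.1 rfl).symm, h⟩
    rw [e]
    apply mul_div_cancel_right₀
    apply ne_of_gt
    apply Finset.sum_pos' (fun z _ => hs0 z)
    exact ⟨w, Finset.mem_filter.2 ⟨Finset.mem_univ _, fun _ => rfl, fun _ _ => Iff.rfl⟩, hwpos⟩
  have hDpos : 0 < ∑ z ∈ univ.filter (fun z : Platform n =>
      FN.Agrees zs.2.2 zs.1 zs.2.1 z.1 z.2.1), σs k z := by
    apply Finset.sum_pos' (fun z _ => hs0 z)
    exact ⟨zs, by simp [FN.Agrees], hzpos⟩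
  have hlt : ∑ z ∈ univ.filter (fun z : Platform n =>
      z.1 = Policy.h ∧ FN.Agrees zs.2.2 zs.1 zs.2.1 z.1 z.2.1), σs k z
      < ∑ z ∈ univ.filter (fun z : Platform n =>
      FN.Agrees zs.2.2 zs.1 zs.2.1 z.1 z.2.1), σs k z := by
    apply Finset.sum_lt_sum_of_subset (i := zs)
    · intro z hz
      simp only [Finset.mem_filter, Finset.mem_univ, true_and] at hz ⊢
      exact hz.2
    · simp [FN.Agrees]
    · simp [hzs]
    · exact hzpos
    · exact fun z _ _ => hs0 z
  have hcz : FN.condProb q (σs k) zs.1 zs.2.1 zs.2.2 < q := by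
    unfold FN.condProb
    rw [div_lt_iff₀ hDpos]
    exact mul_lt_mul_of_pos_left hlt hq0
  have hcz0 : 0 ≤ FN.condProb q (σs k) zs.1 zs.2.1 zs.2.2 := by
    unfold FN.condProb
    exact div_nonneg (mul_nonneg hq0.le (Finset.sum_nonneg fun z _ => hs0 z)) hDpos.le
  rw [hcw] at hle
  have hFh : ∑ i ∈ w.2.1, f i w.1 = FN.Fval f Policy.h univ := by
    unfold FN.Fval
    apply Finset.sum_subset (Finset.subset_univ _)
    intro i _ hi
    have : ¬ 0 < f i Policy.h := by simpa [w, FN.Nset] using hi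
    exact le_antisymm (not_lt.1 this) (hf0 i _)
  have hFl : ∑ i ∈ zs.2.1, f i zs.1 + FN.Fval f Policy.l S ≤ FN.Fval f Policy.l univ := by
    unfold FN.Fval
    have : Disjoint zs.2.1 S := Finset.sdiff_disjoint
    change ∑ i ∈ zs.2.1, f i Policy.l + _ ≤ _
    rw [← Finset.sum_union this]
    exact Finset.sum_le_sum_of_subset_of_nonneg (Finset.subset_univ _) (fun i _ _ => hf0 i _)
  have hFhpos : 0 < FN.Fval f Policy.h univ := by
    obtain ⟨i, hi⟩ := hf2 Policy.h
    exact Finset.sum_pos' (fun i _ => hf0 i _) ⟨i, Finset.mem_univ _, hi⟩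
  rw [hFh] at hle
  have h1 := mul_le_mul_of_nonneg_left
    (show ∑ i ∈ zs.2.1, f i zs.1 ≤ FN.Fval f Policy.h univ by linarith) hcz0
  have h2 := mul_lt_mul_of_pos_right hcz hFhpos
  linarith
end
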